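/- arXiv:0908.4537 — 2 statements merged into one kernel-verified Lean document; each statement's English description precedes it below -/
import Mathlib

section
/- Let θ be a real antisymmetric 4 × 4 matrix. For all x⃗, y⃗ ∈ ℝ³ and all x₄ > 0, y₄ > 0, the value f₂^θ((0,x⃗) − i(x₄,0), (0,y⃗) − i(y₄,0)) equals the iterated Euclidean integral with on-shell twisting (2π)^{−8} ∫_{ℝ³} ∫_{ℝ} ∫_{ℝ³} ∫_{ℝ} e^{i(⟨k, x⃗⟩ + k₄ x₄ + ⟨p, y⃗⟩ + p₄ y₄)} e^{−i⟨p̃, θ k̃⟩} / ( (|k|² + k₄² + m²)(|p|² + p₄² + m²) ) dk₄ dk dp₄ dp, where k̃ = (ω(k), k) and p̃ = (ω(p), p) depend only on the three-dimensional momenta k and p (not on k₄, p₄), and all iterated integrals converge absolutely in the indicated order. This identifies the noncommutative Schwinger function s₂^θ(x, y) for x₄, y₄ > 0: it differs from the untwisted Schwinger function s₂ only by the on-shell oscillating factor e^{−i⟨p̃, θ k̃⟩}. -/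
open MeasureTheory

/-- The on-shell energy `ω(k) = √(|k|² + m²)` for `k ∈ ℝ³`. -/
noncomputable def omega (m : ℝ) (k : Fin 3 → ℝ) : ℝ :=
  Real.sqrt ((∑ i, k i ^ 2) + m ^ 2)

/-- The on-shell four-momentum `k̃ = (ω(k), k) ∈ ℝ⁴`. -/
noncomputable def onShell (m : ℝ) (k : Fin 3 → ℝ) : Fin 4 → ℝ :=
  ![omega m k, k 0, k 1, k 2]

/-- The on-shell twisting pairing `⟨p̃, θ k̃⟩ = p̃ · (θ k̃)`; it depends only on the
three-dimensional momenta `k` and `p`, not on `k₄, p₄`. -/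
noncomputable def twist (m : ℝ) (θ : Matrix (Fin 4) (Fin 4) ℝ) (k p : Fin 3 → ℝ) : ℝ :=
  ∑ i : Fin 4, onShell m p i * ∑ j : Fin 4, θ i j * onShell m k j

/-- The analytic function `f₂^θ(z, w)` whose boundary value is the twisted tensor
product `Δ₊^{(⋆2)}`. -/
noncomputable def f₂θAna (m : ℝ) (θ : Matrix (Fin 4) (Fin 4) ℝ)
    (z w : ℂ × (Fin 3 → ℂ)) : ℂ :=
  ((((2 * Real.pi) ^ 6)⁻¹ : ℝ) : ℂ) *
    ∫ kp : (Fin 3 → ℝ) × (Fin 3 → ℝ),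
      Complex.exp (-Complex.I * (omega m kp.1 : ℂ) * z.1 +
          Complex.I * ∑ i, (kp.1 i : ℂ) * z.2 i) *
        Complex.exp (-Complex.I * (omega m kp.2 : ℂ) * w.1 +
          Complex.I * ∑ i, (kp.2 i : ℂ) * w.2 i) *
        Complex.exp (-Complex.I * ((twist m θ kp.1 kp.2 : ℝ) : ℂ)) /
        (4 * (omega m kp.1 : ℂ) * (omega m kp.2 : ℂ))

/-- The twisted Euclidean integrand
`e^{i(⟨k,x⃗⟩+k₄x₄+⟨p,y⃗⟩+p₄y₄)} e^{−i⟨p̃,θk̃⟩} / ((|k|²+k₄²+m²)(|p|²+p₄²+m²))`. -/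
noncomputable def eucIntTw (m : ℝ) (θ : Matrix (Fin 4) (Fin 4) ℝ)
    (xv : Fin 3 → ℝ) (x₄ : ℝ) (yv : Fin 3 → ℝ) (y₄ : ℝ)
    (p : Fin 3 → ℝ) (p₄ : ℝ) (k : Fin 3 → ℝ) (k₄ : ℝ) : ℂ :=
  Complex.exp (Complex.I *
      (((∑ i, k i * xv i) + k₄ * x₄ + (∑ i, p i * yv i) + p₄ * y₄ : ℝ) : ℂ)) *
    Complex.exp (-Complex.I * ((twist m θ k p : ℝ) : ℂ)) /
    (((((∑ i, k i ^ 2) + k₄ ^ 2 + m ^ 2) * ((∑ i, p i ^ 2) + p₄ ^ 2 + m ^ 2) : ℝ) : ℂ))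

open FourierTransform in
/-- The Fourier transform of `x ↦ e^{-a|x|}`. -/
lemma fourier_exp_neg_mul_abs {a : ℝ} (ha : 0 < a) (ξ : ℝ) :
    𝓕 (fun x : ℝ => ((Real.exp (-a * |x|) : ℝ) : ℂ)) ξ =
      ((2 * a * (a ^ 2 + (2 * Real.pi * ξ) ^ 2)⁻¹ : ℝ) : ℂ) := by
  rw [Real.fourier_eq']
  set b : ℂ := ((2 * Real.pi * ξ : ℝ) : ℂ) * Complex.I with hb
  have hre : b.re = 0 := by simp [hb]
  have h1 : Set.EqOn (fun v : ℝ => Complex.exp (↑(-2 * Real.pi * inner ℝ v ξ) * Complex.I) •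
      ((Real.exp (-a * |v|) : ℝ) : ℂ)) (fun v : ℝ => Complex.exp ((-a - b) * v)) (Set.Ioi 0) := by
    intro v hv
    simp only [Set.mem_Ioi] at hv
    simp only [abs_of_pos hv, smul_eq_mul, Complex.ofReal_exp]
    rw [← Complex.exp_add]
    congr 1
    simp [hb]
    ring
  have h2 : Set.EqOn (fun v : ℝ => Complex.exp (↑(-2 * Real.pi * inner ℝ v ξ) * Complex.I) •
      ((Real.exp (-a * |v|) : ℝ) : ℂ)) (fun v : ℝ => Complex.exp ((a - b) * v)) (Set.Iic 0) := by
    intro v hv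
    simp only [Set.mem_Iic] at hv
    simp only [abs_of_nonpos hv, smul_eq_mul, Complex.ofReal_exp]
    rw [← Complex.exp_add]
    congr 1
    simp [hb]
    ring
  have hr1 : (-(a : ℂ) - b).re < 0 := by simp [hre, ha]
  have hr2 : 0 < ((a : ℂ) - b).re := by simp [hre, ha]
  have i1 := (integrableOn_exp_mul_complex_Ioi hr1 0).congr_fun h1.symm measurableSet_Ioi
  have i2 := (integrableOn_exp_mul_complex_Iic hr2 0).congr_fun h2.symm measurableSet_Iic
  rw [← intervalIntegral.integral_Iic_add_Ioi i2 i1, setIntegral_congr_fun measurableSet_Ioi h1,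
    setIntegral_congr_fun measurableSet_Iic h2, integral_exp_mul_complex_Ioi hr1,
    integral_exp_mul_complex_Iic hr2]
  have n1 : -(a : ℂ) - b ≠ 0 := fun h => by simp [h] at hr1
  have n2 : (a : ℂ) - b ≠ 0 := fun h => by simp [h] at hr2
  have hb2 : b ^ 2 = -(2 * Real.pi * ξ) ^ 2 := by
    rw [hb, mul_pow, Complex.I_sq]; push_cast; ring
  simp only [Complex.ofReal_zero, mul_zero, Complex.exp_zero]
  have hd : (a : ℂ) ^ 2 + (2 * Real.pi * ξ) ^ 2 = -((a - b) * (-a - b)) := by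
    linear_combination hb2
  push_cast
  rw [hd]
  clear_value b
  field_simp
  ring

lemma integrable_exp_neg_mul_abs {a : ℝ} (ha : 0 < a) :
    Integrable fun x : ℝ => Real.exp (-a * |x|) := by
  rw [← integrableOn_univ, ← Set.Iic_union_Ioi (a := (0 : ℝ))]
  refine IntegrableOn.union ?_ ?_
  · refine (integrableOn_exp_mul_Iic ha 0).congr_fun (fun x hx => ?_) measurableSet_Iic
    simp [abs_of_nonpos (Set.mem_Iic.1 hx)]
  · refine (integrableOn_exp_mul_Ioi (neg_lt_zero.2 ha) 0).congr_fun (fun x hx => ?_)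
      measurableSet_Ioi
    simp [abs_of_pos (Set.mem_Ioi.1 hx)]

lemma integrable_inv_sq_add_sq {a : ℝ} (ha : 0 < a) :
    Integrable fun s : ℝ => (s ^ 2 + a ^ 2)⁻¹ := by
  refine ((integrable_inv_one_add_sq.comp_mul_left' (inv_ne_zero ha.ne')).const_mul
    ((a ^ 2)⁻¹)).congr (.of_forall fun s => ?_)
  have : a ^ 2 + s ^ 2 ≠ 0 := by positivity
  simp only
  field_simp
  ring

lemma norm_cexp_I_mul_ofReal (r : ℝ) : ‖Complex.exp (Complex.I * (r : ℂ))‖ = 1 := by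
  rw [mul_comm, Complex.norm_exp_ofReal_mul_I]

lemma integrable_cexp_div_sq_add_sq {a : ℝ} (ha : 0 < a) (t : ℝ) :
    Integrable fun s : ℝ => Complex.exp (Complex.I * ((s * t : ℝ) : ℂ)) /
      ((s ^ 2 + a ^ 2 : ℝ) : ℂ) := by
  refine (integrable_inv_sq_add_sq ha).mono' ?_ (.of_forall fun s => ?_)
  · exact Measurable.aestronglyMeasurable (by fun_prop)
  · rw [norm_div, norm_cexp_I_mul_ofReal, Complex.norm_real, Real.norm_of_nonneg (by positivity),
      one_div]

open FourierTransform in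
/-- The Fourier integral of the Lorentzian `s ↦ 1 / (s² + a²)`. -/
lemma integral_cexp_div_sq_add_sq {a : ℝ} (ha : 0 < a) {t : ℝ} (ht : 0 ≤ t) :
    ∫ s : ℝ, Complex.exp (Complex.I * ((s * t : ℝ) : ℂ)) / ((s ^ 2 + a ^ 2 : ℝ) : ℂ) =
      ((Real.pi / a * Real.exp (-a * t) : ℝ) : ℂ) := by
  set f : ℝ → ℂ := fun x => ((Real.exp (-a * |x|) : ℝ) : ℂ) with hf
  have hF : 𝓕 f = fun ξ : ℝ => ((2 * a * (a ^ 2 + (2 * Real.pi * ξ) ^ 2)⁻¹ : ℝ) : ℂ) :=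
    funext (fourier_exp_neg_mul_abs ha)
  have hFint : Integrable (𝓕 f) := by
    rw [hF]
    refine Integrable.ofReal (Integrable.const_mul ?_ _)
    simpa only [add_comm] using
      (integrable_inv_sq_add_sq ha).comp_mul_left' (R := 2 * Real.pi) (by positivity)
  have hinv := (show Continuous f by fun_prop).fourierInv_fourier_eq
    (integrable_exp_neg_mul_abs ha).ofReal hFint
  have hpt := congrFun hinv t
  rw [Real.fourierInv_eq', hF] at hpt
  have hsub := Measure.integral_comp_mul_left (fun s : ℝ =>
    Complex.exp (Complex.I * ((s * t : ℝ) : ℂ)) / ((s ^ 2 + a ^ 2 : ℝ) : ℂ)) (2 * Real.pi)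
  have hEq : ∀ ξ : ℝ, Complex.exp (↑(2 * Real.pi * inner ℝ ξ t) * Complex.I) •
      ((2 * a * (a ^ 2 + (2 * Real.pi * ξ) ^ 2)⁻¹ : ℝ) : ℂ) =
      (2 * a : ℂ) * (Complex.exp (Complex.I * ((2 * Real.pi * ξ * t : ℝ) : ℂ)) /
        (((2 * Real.pi * ξ) ^ 2 + a ^ 2 : ℝ) : ℂ)) := by
    intro ξ
    have : (2 * Real.pi * inner ℝ ξ t : ℝ) = 2 * Real.pi * ξ * t := by
      simp; ring
    rw [this, mul_comm Complex.I, add_comm ((2 * Real.pi * ξ) ^ 2), smul_eq_mul]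
    push_cast
    ring
  simp_rw [hEq] at hpt
  rw [integral_const_mul, hsub, abs_of_pos (by positivity), hf] at hpt
  simp only [abs_of_nonneg ht, Complex.real_smul] at hpt
  have hπ : (Real.pi : ℂ) ≠ 0 := by exact_mod_cast Real.pi_ne_zero
  have ha' : (a : ℂ) ≠ 0 := by exact_mod_cast ha.ne'
  push_cast at hpt ⊢
  rw [← hpt]
  generalize (∫ s : ℝ, Complex.exp (Complex.I * (s * t)) / ((s : ℂ) ^ 2 + a ^ 2)) = J
  field_simp

lemma omega_pos {m : ℝ} (hm : 0 < m) (k : Fin 3 → ℝ) : 0 < omega m k := by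
  have : 0 ≤ ∑ i, k i ^ 2 := Finset.sum_nonneg fun i _ => sq_nonneg _
  exact Real.sqrt_pos.2 (by positivity)

lemma sq_omega (m : ℝ) (k : Fin 3 → ℝ) : omega m k ^ 2 = (∑ i, k i ^ 2) + m ^ 2 := by
  have : 0 ≤ ∑ i, k i ^ 2 := Finset.sum_nonneg fun i _ => sq_nonneg _
  exact Real.sq_sqrt (by positivity)

lemma le_omega (m : ℝ) (k : Fin 3 → ℝ) : m ≤ omega m k := by
  have : 0 ≤ ∑ i, k i ^ 2 := Finset.sum_nonneg fun i _ => sq_nonneg _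
  exact Real.le_sqrt_of_sq_le (by linarith)

lemma abs_le_omega (m : ℝ) (k : Fin 3 → ℝ) (i : Fin 3) : |k i| ≤ omega m k := by
  have := Finset.single_le_sum (f := fun i => k i ^ 2) (fun i _ => sq_nonneg _) (Finset.mem_univ i)
  refine Real.le_sqrt_of_sq_le ?_
  rw [sq_abs]
  nlinarith [sq_nonneg m]

@[fun_prop]
lemma continuous_omega (m : ℝ) : Continuous (omega m) := by
  unfold omega
  fun_prop

@[fun_prop]
lemma Continuous.twist {X : Type*} [TopologicalSpace X] {f g : X → Fin 3 → ℝ}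
    (hf : Continuous f) (hg : Continuous g) (m : ℝ) (θ : Matrix (Fin 4) (Fin 4) ℝ) :
    Continuous fun a => twist m θ (f a) (g a) := by
  simp only [_root_.twist, onShell, Fin.sum_univ_four, Matrix.cons_val]
  fun_prop

lemma integrable_exp_neg_omega_mul_div {m t : ℝ} (hm : 0 < m) (ht : 0 < t) :
    Integrable fun k : Fin 3 → ℝ => Real.exp (-omega m k * t) / omega m k := by
  have hprod : Integrable fun k : Fin 3 → ℝ => ∏ i, Real.exp (-(t / 3) * |k i|) :=
    Integrable.fintype_prod (f := fun _ x => Real.exp (-(t / 3) * |x|)) fun _ =>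
      integrable_exp_neg_mul_abs (by positivity)
  refine (hprod.const_mul m⁻¹).mono' ?_ (.of_forall fun k => ?_)
  · exact Measurable.aestronglyMeasurable (by fun_prop)
  · have hω := omega_pos hm k
    rw [Real.norm_of_nonneg (by positivity), ← Real.exp_sum, div_eq_inv_mul]
    refine mul_le_mul (inv_anti₀ hm (le_omega m k)) (Real.exp_le_exp.2 ?_) (by positivity)
      (by positivity)
    rw [Fin.sum_univ_three]
    nlinarith [abs_le_omega m k 0, abs_le_omega m k 1, abs_le_omega m k 2]

/-- The plane wave `e^{i⟨k,x⟩}` damped by `e^{-ω(k)t} / ω(k)`. -/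
noncomputable def dampedWave (m : ℝ) (x : Fin 3 → ℝ) (t : ℝ) (k : Fin 3 → ℝ) : ℂ :=
  Complex.exp (Complex.I * ((∑ i, k i * x i : ℝ) : ℂ)) *
    ((Real.exp (-omega m k * t) / omega m k : ℝ) : ℂ)

lemma integrable_dampedWave {m t : ℝ} (hm : 0 < m) (ht : 0 < t) (x : Fin 3 → ℝ) :
    Integrable (dampedWave m x t) := by
  refine (integrable_exp_neg_omega_mul_div hm ht).mono' ?_ (.of_forall fun k => ?_)
  · exact Measurable.aestronglyMeasurable (by unfold dampedWave; fun_prop)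
  · have hω := omega_pos hm k
    rw [dampedWave, norm_mul, norm_cexp_I_mul_ofReal, Complex.norm_real,
      Real.norm_of_nonneg (by positivity), one_mul]

/-- The product of two damped waves with the on-shell twisting factor. -/
noncomputable def twistedWave (m : ℝ) (θ : Matrix (Fin 4) (Fin 4) ℝ) (x : Fin 3 → ℝ) (t : ℝ)
    (y : Fin 3 → ℝ) (s : ℝ) (q : (Fin 3 → ℝ) × (Fin 3 → ℝ)) : ℂ :=
  Complex.exp (Complex.I * ((-twist m θ q.1 q.2 : ℝ) : ℂ)) *
    (dampedWave m x t q.1 * dampedWave m y s q.2)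

lemma integrable_twistedWave {m t s : ℝ} (hm : 0 < m) (ht : 0 < t) (hs : 0 < s)
    (θ : Matrix (Fin 4) (Fin 4) ℝ) (x y : Fin 3 → ℝ) :
    Integrable (twistedWave m θ x t y s) := by
  refine ((integrable_dampedWave hm ht x).mul_prod (integrable_dampedWave hm hs y)).bdd_mul
    (c := 1) (Continuous.aestronglyMeasurable (by fun_prop)) (.of_forall fun q => ?_)
  exact (norm_cexp_I_mul_ofReal _).le

lemma integrable_twistedWave_left {m t : ℝ} (hm : 0 < m) (ht : 0 < t) (s : ℝ)
    (θ : Matrix (Fin 4) (Fin 4) ℝ) (x y p : Fin 3 → ℝ) :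
    Integrable fun k => twistedWave m θ x t y s (k, p) := by
  have hphase : AEStronglyMeasurable fun k : Fin 3 → ℝ =>
      Complex.exp (Complex.I * ((-twist m θ k p : ℝ) : ℂ)) :=
    Continuous.aestronglyMeasurable (by fun_prop)
  exact ((integrable_dampedWave hm ht x).mul_const (dampedWave m y s p)).bdd_mul
    (c := 1) hphase (.of_forall fun k => (norm_cexp_I_mul_ofReal _).le)

lemma eucIntTw_eq {m : ℝ} (hm : 0 < m) (θ : Matrix (Fin 4) (Fin 4) ℝ)
    (x : Fin 3 → ℝ) (t : ℝ) (y : Fin 3 → ℝ) (s : ℝ)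
    (p : Fin 3 → ℝ) (p₄ : ℝ) (k : Fin 3 → ℝ) (k₄ : ℝ) :
    eucIntTw m θ x t y s p p₄ k k₄ =
      ((omega m p * Real.exp (omega m p * s) : ℝ) : ℂ) *
        (Complex.exp (Complex.I * ((p₄ * s : ℝ) : ℂ)) / ((p₄ ^ 2 + omega m p ^ 2 : ℝ) : ℂ)) *
        (((omega m k * Real.exp (omega m k * t) : ℝ) : ℂ) * twistedWave m θ x t y s (k, p)) *
        (Complex.exp (Complex.I * ((k₄ * t : ℝ) : ℂ)) /
          ((k₄ ^ 2 + omega m k ^ 2 : ℝ) : ℂ)) := by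
  have hk := omega_pos hm k
  have hp := omega_pos hm p
  have cancel : ∀ (w r : ℝ), 0 < w → ((w * Real.exp (w * r) : ℝ) : ℂ) *
      ((Real.exp (-w * r) / w : ℝ) : ℂ) = 1 := by
    intro w r hw
    rw [← Complex.ofReal_mul, neg_mul, Real.exp_neg]
    field_simp
    simp
  have hexp : Complex.exp (Complex.I *
      (((∑ i, k i * x i) + k₄ * t + (∑ i, p i * y i) + p₄ * s : ℝ) : ℂ)) =
      Complex.exp (Complex.I * ((∑ i, k i * x i : ℝ) : ℂ)) *
      Complex.exp (Complex.I * ((k₄ * t : ℝ) : ℂ)) *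
      Complex.exp (Complex.I * ((∑ i, p i * y i : ℝ) : ℂ)) *
      Complex.exp (Complex.I * ((p₄ * s : ℝ) : ℂ)) := by
    simp only [← Complex.exp_add, ← mul_add, ← Complex.ofReal_add]
  have hden : ((∑ i, k i ^ 2) + k₄ ^ 2 + m ^ 2) * ((∑ i, p i ^ 2) + p₄ ^ 2 + m ^ 2) =
      (k₄ ^ 2 + omega m k ^ 2) * (p₄ ^ 2 + omega m p ^ 2) := by
    rw [sq_omega, sq_omega]; ring
  have htw : -Complex.I * ((twist m θ k p : ℝ) : ℂ) =
      Complex.I * ((-twist m θ k p : ℝ) : ℂ) := by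
    push_cast; ring
  rw [eucIntTw, hexp, hden, htw, Complex.ofReal_mul (k₄ ^ 2 + _), twistedWave, dampedWave,
    dampedWave]
  simp only
  generalize Complex.exp (Complex.I * ((-twist m θ k p : ℝ) : ℂ)) = T
  generalize Complex.exp (Complex.I * ((∑ i, k i * x i : ℝ) : ℂ)) = A
  generalize Complex.exp (Complex.I * ((∑ i, p i * y i : ℝ) : ℂ)) = B
  generalize Complex.exp (Complex.I * ((k₄ * t : ℝ) : ℂ)) = C
  generalize Complex.exp (Complex.I * ((p₄ * s : ℝ) : ℂ)) = D
  have h1 := cancel _ t hk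
  have h2 := cancel _ s hp
  generalize ((omega m k * Real.exp (omega m k * t) : ℝ) : ℂ) = u at *
  generalize ((Real.exp (-omega m k * t) / omega m k : ℝ) : ℂ) = u' at *
  generalize ((omega m p * Real.exp (omega m p * s) : ℝ) : ℂ) = v at *
  generalize ((Real.exp (-omega m p * s) / omega m p : ℝ) : ℂ) = v' at *
  calc _ = A * C * B * D * T / (((k₄ ^ 2 + omega m k ^ 2 : ℝ) : ℂ) *
        ((p₄ ^ 2 + omega m p ^ 2 : ℝ) : ℂ)) * (u * u') * (v * v') := by rw [h1, h2]; ring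
    _ = _ := by ring

lemma integral_eucIntTw {m t : ℝ} (hm : 0 < m) (ht : 0 < t) (θ : Matrix (Fin 4) (Fin 4) ℝ)
    (x y : Fin 3 → ℝ) (s : ℝ) (p : Fin 3 → ℝ) (p₄ : ℝ) (k : Fin 3 → ℝ) :
    ∫ k₄ : ℝ, eucIntTw m θ x t y s p p₄ k k₄ =
      ((omega m p * Real.exp (omega m p * s) : ℝ) : ℂ) * Real.pi *
        (Complex.exp (Complex.I * ((p₄ * s : ℝ) : ℂ)) / ((p₄ ^ 2 + omega m p ^ 2 : ℝ) : ℂ)) *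
        twistedWave m θ x t y s (k, p) := by
  have hk := omega_pos hm k
  simp only [eucIntTw_eq hm]
  rw [integral_const_mul, integral_cexp_div_sq_add_sq hk ht.le]
  have : ((omega m k * Real.exp (omega m k * t) : ℝ) : ℂ) *
      ((Real.pi / omega m k * Real.exp (-omega m k * t) : ℝ) : ℂ) = (Real.pi : ℂ) := by
    rw [← Complex.ofReal_mul, neg_mul, Real.exp_neg]
    congr 1
    field_simp
  rw [← this]
  ring

lemma integral_integral_eucIntTw {m t : ℝ} (hm : 0 < m) (ht : 0 < t)
    (θ : Matrix (Fin 4) (Fin 4) ℝ) (x y : Fin 3 → ℝ) (s : ℝ) (p : Fin 3 → ℝ) (p₄ : ℝ) :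
    ∫ k : Fin 3 → ℝ, ∫ k₄ : ℝ, eucIntTw m θ x t y s p p₄ k k₄ =
      ((omega m p * Real.exp (omega m p * s) : ℝ) : ℂ) * Real.pi *
        (∫ k, twistedWave m θ x t y s (k, p)) *
        (Complex.exp (Complex.I * ((p₄ * s : ℝ) : ℂ)) /
          ((p₄ ^ 2 + omega m p ^ 2 : ℝ) : ℂ)) := by
  simp only [integral_eucIntTw hm ht]
  rw [integral_const_mul]
  ring

lemma integral_integral_integral_eucIntTw {m t s : ℝ} (hm : 0 < m) (ht : 0 < t) (hs : 0 < s)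
    (θ : Matrix (Fin 4) (Fin 4) ℝ) (x y p : Fin 3 → ℝ) :
    ∫ p₄ : ℝ, ∫ k : Fin 3 → ℝ, ∫ k₄ : ℝ, eucIntTw m θ x t y s p p₄ k k₄ =
      (Real.pi : ℂ) ^ 2 * ∫ k, twistedWave m θ x t y s (k, p) := by
  have hp := omega_pos hm p
  simp only [integral_integral_eucIntTw hm ht]
  rw [integral_const_mul, integral_cexp_div_sq_add_sq hp hs.le]
  have : ((omega m p * Real.exp (omega m p * s) : ℝ) : ℂ) *
      ((Real.pi / omega m p * Real.exp (-omega m p * s) : ℝ) : ℂ) = (Real.pi : ℂ) := by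
    rw [← Complex.ofReal_mul, neg_mul, Real.exp_neg]
    congr 1
    field_simp
  linear_combination (Real.pi : ℂ) * (∫ k, twistedWave m θ x t y s (k, p)) * this

lemma f₂θAna_eq (m : ℝ) (θ : Matrix (Fin 4) (Fin 4) ℝ) (x y : Fin 3 → ℝ) (t s : ℝ) :
    f₂θAna m θ (((0 : ℝ) : ℂ) - Complex.I * (t : ℂ), fun i => ((x i : ℝ) : ℂ))
        (((0 : ℝ) : ℂ) - Complex.I * (s : ℂ), fun i => ((y i : ℝ) : ℂ)) =
      ((((2 * Real.pi) ^ 6)⁻¹ / 4 : ℝ) : ℂ) * ∫ q, twistedWave m θ x t y s q := by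
  have hexp : ∀ (k z : Fin 3 → ℝ) (r : ℝ),
      Complex.exp (-Complex.I * (omega m k : ℂ) * (((0 : ℝ) : ℂ) - Complex.I * (r : ℂ)) +
          Complex.I * ∑ i, (k i : ℂ) * (z i : ℂ)) =
        Complex.exp (Complex.I * ((∑ i, k i * z i : ℝ) : ℂ)) *
          ((Real.exp (-omega m k * r) : ℝ) : ℂ) := by
    intro k z r
    rw [Complex.ofReal_exp, ← Complex.exp_add]
    congr 1
    push_cast
    linear_combination ((omega m k : ℂ) * r) * Complex.I_sq
  rw [f₂θAna, Complex.ofReal_div, div_mul_eq_mul_div, mul_div_assoc, ← integral_div]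
  congr 2
  ext q
  rw [hexp, hexp, twistedWave, dampedWave, dampedWave]
  push_cast
  rw [mul_neg, ← neg_mul]
  ring

/-- For `x₄, y₄ > 0`, the value `f₂^θ((0,x⃗) − i(x₄,0), (0,y⃗) − i(y₄,0))` equals the
iterated Euclidean integral with on-shell twisting
`(2π)⁻⁸ ∫_{ℝ³}∫_ℝ∫_{ℝ³}∫_ℝ e^{i(⟨k,x⃗⟩+k₄x₄+⟨p,y⃗⟩+p₄y₄)} e^{−i⟨p̃,θk̃⟩}
/((|k|²+k₄²+m²)(|p|²+p₄²+m²)) dk₄ dk dp₄ dp`,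
all iterated integrals converging absolutely in the indicated order. This identifies
the noncommutative Schwinger function `s₂^θ(x, y)` for `x₄, y₄ > 0`. -/
theorem schwinger_function_s₂θ (m : ℝ) (hm : 0 < m)
    (θ : Matrix (Fin 4) (Fin 4) ℝ) (hθ : θ.transpose = -θ)
    (xv yv : Fin 3 → ℝ) (x₄ y₄ : ℝ) (hx₄ : 0 < x₄) (hy₄ : 0 < y₄) :
    (∀ (p : Fin 3 → ℝ) (p₄ : ℝ) (k : Fin 3 → ℝ),
      Integrable (fun k₄ : ℝ => eucIntTw m θ xv x₄ yv y₄ p p₄ k k₄)) ∧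
    (∀ (p : Fin 3 → ℝ) (p₄ : ℝ),
      Integrable (fun k : Fin 3 → ℝ => ∫ k₄ : ℝ, eucIntTw m θ xv x₄ yv y₄ p p₄ k k₄)) ∧
    (∀ p : Fin 3 → ℝ,
      Integrable (fun p₄ : ℝ =>
        ∫ k : Fin 3 → ℝ, ∫ k₄ : ℝ, eucIntTw m θ xv x₄ yv y₄ p p₄ k k₄)) ∧
    Integrable (fun p : Fin 3 → ℝ =>
      ∫ p₄ : ℝ, ∫ k : Fin 3 → ℝ, ∫ k₄ : ℝ, eucIntTw m θ xv x₄ yv y₄ p p₄ k k₄) ∧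
    f₂θAna m θ (((0 : ℝ) : ℂ) - Complex.I * (x₄ : ℂ), fun i => ((xv i : ℝ) : ℂ))
          (((0 : ℝ) : ℂ) - Complex.I * (y₄ : ℂ), fun i => ((yv i : ℝ) : ℂ)) =
      ((((2 * Real.pi) ^ 8)⁻¹ : ℝ) : ℂ) *
        ∫ p : Fin 3 → ℝ, ∫ p₄ : ℝ, ∫ k : Fin 3 → ℝ, ∫ k₄ : ℝ,
          eucIntTw m θ xv x₄ yv y₄ p p₄ k k₄ := by
  simp only [integral_integral_integral_eucIntTw hm hx₄ hy₄]
  have hint := integrable_twistedWave hm hx₄ hy₄ θ xv yv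
  refine ⟨fun p p₄ k => ?_, fun p p₄ => ?_, fun p => ?_, ?_, ?_⟩
  · simp only [eucIntTw_eq hm]
    exact (integrable_cexp_div_sq_add_sq (omega_pos hm k) x₄).const_mul _
  · simp only [integral_eucIntTw hm hx₄]
    exact (integrable_twistedWave_left hm hx₄ y₄ θ xv yv p).const_mul _
  · simp only [integral_integral_eucIntTw hm hx₄]
    exact (integrable_cexp_div_sq_add_sq (omega_pos hm p) y₄).const_mul _
  · exact hint.integral_prod_right.const_mul _
  · have hπ : (Real.pi : ℂ) ≠ 0 := by exact_mod_cast Real.pi_ne_zero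
    rw [f₂θAna_eq, integral_const_mul, Measure.volume_eq_prod, integral_prod_symm _ hint]
    push_cast
    field_simp
    ring
end

section
/- The Fourier transform of the noncommutative Schwinger function is in general not symmetric under reflection in the origin: there exist a nondegenerate real antisymmetric 4 × 4 matrix θ and vectors k = (k⃗, k₄), p = (p⃗, p₄) ∈ ℝ³ × ℝ such that S̃₂^θ(−k, −p) ≠ S̃₂^θ(k, p), where S̃₂^θ(k, p) := e^{−i⟨p̃, θ k̃⟩} / ( (|k⃗|² + k₄² + m²)(|p⃗|² + p₄² + m²) ) with on-shell momenta k̃ = (ω(k⃗), k⃗), p̃ = (ω(p⃗), p⃗), and the reflection sends (k⃗, k₄) to (−k⃗, −k₄), so that the reflected twisting is e^{−i⟨(ω(p⃗),−p⃗), θ (ω(k⃗),−k⃗)⟩}. -/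
open MeasureTheory

/-- The Fourier transform of the noncommutative Schwinger function,
`S̃₂^θ(k, p) = e^{−i⟨p̃,θk̃⟩} / ((|k⃗|²+k₄²+m²)(|p⃗|²+p₄²+m²))`, evaluated at
`k = (k⃗, k₄)`, `p = (p⃗, p₄)`. -/
noncomputable def S₂θ (m : ℝ) (θ : Matrix (Fin 4) (Fin 4) ℝ)
    (kv : Fin 3 → ℝ) (k₄ : ℝ) (pv : Fin 3 → ℝ) (p₄ : ℝ) : ℂ :=
  Complex.exp (-Complex.I * ((twist m θ kv pv : ℝ) : ℂ)) /
    (((((∑ i, kv i ^ 2) + k₄ ^ 2 + m ^ 2) *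
      ((∑ i, pv i ^ 2) + p₄ ^ 2 + m ^ 2) : ℝ) : ℂ))

theorem omega_zero {m : ℝ} (hm : 0 ≤ m) : omega m 0 = m := by
  simp [omega, Real.sqrt_sq hm]

/-- The block-diagonal antisymmetric matrix with entries `∓a` and `±1`. -/
def blockTheta (a : ℝ) : Matrix (Fin 4) (Fin 4) ℝ :=
  !![0, -a, 0, 0; a, 0, 0, 0; 0, 0, 0, 1; 0, 0, -1, 0]

theorem transpose_blockTheta (a : ℝ) : (blockTheta a).transpose = -blockTheta a := by
  ext i j
  fin_cases i <;> fin_cases j <;> simp [blockTheta]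

theorem det_blockTheta (a : ℝ) : (blockTheta a).det = a ^ 2 := by
  simp [blockTheta, Matrix.det_succ_row_zero, Fin.sum_univ_succ, Fin.succAbove]
  ring

theorem twist_blockTheta_zero {m : ℝ} (hm : 0 ≤ m) (a : ℝ) (p : Fin 3 → ℝ) :
    twist m (blockTheta a) 0 p = p 0 * (a * m) := by
  simp [twist, onShell, blockTheta, omega_zero hm, Fin.sum_univ_succ]

/-- The Fourier transform of the noncommutative Schwinger function is in general not
symmetric under reflection in the origin: there are a nondegenerate real antisymmetric
`4 × 4` matrix `θ` and momenta `(k⃗, k₄)`, `(p⃗, p₄)` with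
`S̃₂^θ(−k, −p) ≠ S̃₂^θ(k, p)`. -/
theorem schwinger_not_reflection_symmetric (m : ℝ) (hm : 0 < m) :
    ∃ θ : Matrix (Fin 4) (Fin 4) ℝ, θ.transpose = -θ ∧ θ.det ≠ 0 ∧
      ∃ (kv pv : Fin 3 → ℝ) (k₄ p₄ : ℝ),
        S₂θ m θ (-kv) (-k₄) (-pv) (-p₄) ≠ S₂θ m θ kv k₄ pv p₄ := by
  have ha : Real.pi / (2 * m) * m = Real.pi / 2 := by field_simp
  refine ⟨blockTheta (Real.pi / (2 * m)), transpose_blockTheta _, ?_,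
    0, ![1, 0, 0], 0, 0, fun h => ?_⟩
  · rw [det_blockTheta]
    positivity
  have hden : (((m ^ 2 * (1 ^ 2 + m ^ 2) : ℝ)) : ℂ) ≠ 0 := by
    exact_mod_cast (by positivity : m ^ 2 * (1 ^ 2 + m ^ 2) ≠ 0)
  have hexp : Complex.exp (Complex.I * (Real.pi / 2)) =
      Complex.exp (-(Complex.I * (Real.pi / 2))) := by
    simp only [S₂θ, neg_zero, twist_blockTheta_zero hm.le, ha] at h
    simp [Fin.sum_univ_succ] at h hden
    exact (div_left_inj' (by simpa using hden)).mp h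
  have hI : Complex.exp (Complex.I * (Real.pi / 2)) = Complex.I := by
    rw [mul_comm, Complex.exp_pi_div_two_mul_I]
  rw [Complex.exp_neg, hI, Complex.inv_I] at hexp
  exact Complex.I_ne_zero (self_eq_neg.mp hexp)
end
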